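/- For every point-shift F there exists a point-shift F_⊥ (given by a measurable point-map) such that for μ-almost every ω: (i) F_⊥ω is a bijection of ω; (ii) for every x ∈ ω the two-sided F_⊥-orbit {F_⊥ω^i(x) : i ∈ ℤ} of x equals the foil L(x) of x (so F_⊥ preserves the foils of F and is dense in each of them); and (iii) on every connected component of G^F(ω) all of whose foils are infinite, the total order ⪯ on each foil defined by x ⪯ F_⊥ω^k(x) for all k ≥ 0 is preserved by F, i.e. x ⪯ y implies F_ω(x) ⪯ F_ω(y). -/

import Mathlib

open Function Set MeasureTheory ProbabilityTheory
open scoped ENNReal NNReal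

namespace PointShift

/-- Points of the grid `ℤ^d`. -/
abbrev Pt (d : ℕ) := Fin d → ℤ

/-- Configurations: subsets of the grid `ℤ^d`, identified with `{0,1}`-valued
functions, equipped with the product σ-algebra. -/
abbrev Conf (d : ℕ) := Pt d → Bool

/-- The shift `θ_t ω = ω - t`. -/
def shift {d : ℕ} (t : Pt d) (ω : Conf d) : Conf d := fun x => ω (x + t)

/-- The support of a configuration, as a subset of `ℤ^d`. -/
def pts {d : ℕ} (ω : Conf d) : Set (Pt d) := {x | ω x = true}

/-- `g` is a point-map: it is measurable and selects a point of every
configuration having a point at the origin. -/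
def IsPointMap {d : ℕ} (g : Conf d → Pt d) : Prop :=
  Measurable g ∧ ∀ ω : Conf d, ω 0 = true → ω (g ω) = true

/-- The point-shift associated with a point-map `g`: `F_ω x = x + g (θ_x ω)`. -/
def Fps {d : ℕ} (g : Conf d → Pt d) (ω : Conf d) (x : Pt d) : Pt d :=
  x + g (shift x ω)

/-- `μ` is a stationary point process on the grid: a shift-invariant probability
measure with a point at the origin with positive probability. -/
def IsStationaryPP {d : ℕ} (μ : Measure (Conf d)) : Prop :=
  IsProbabilityMeasure μ ∧ (∀ t : Pt d, μ.map (shift t) = μ) ∧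
    0 < μ {ω : Conf d | ω 0 = true}

/-- The Palm probability of `μ`: `μ` conditioned on having a point at the origin. -/
noncomputable def Palm {d : ℕ} (μ : Measure (Conf d)) : Measure (Conf d) :=
  μ[|{ω : Conf d | ω 0 = true}]

/-- The foil of the point `x` in the configuration `ω`, for the point-shift of `g`. -/
def foilOn {d : ℕ} (g : Conf d → Pt d) (ω : Conf d) (x : Pt d) : Set (Pt d) :=
  {y | ω y = true ∧ ∃ n : ℕ, (Fps g ω)^[n] y = (Fps g ω)^[n] x}

/-- The connected component of the point `x` in the functional graph `G^F(ω)`. -/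
def compOn {d : ℕ} (g : Conf d → Pt d) (ω : Conf d) (x : Pt d) : Set (Pt d) :=
  {y | ω y = true ∧ ∃ m n : ℕ, (Fps g ω)^[m] x = (Fps g ω)^[n] y}

/-- `K` is a directed cycle of the functional graph of `f`: a finite set of
distinct points `c 0, …, c (k-1)` (with `k ≥ 1`) such that `f (c i) = c ((i+1) % k)`. -/
def IsCycle {X : Type*} (f : X → X) (K : Set X) : Prop :=
  ∃ (k : ℕ) (c : ℕ → X), 0 < k ∧
    (∀ i < k, ∀ j < k, c i = c j → i = j) ∧
    (∀ i < k, f (c i) = c ((i + 1) % k)) ∧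
    K = c '' {i | i < k}

end PointShift

namespace PointShift

section FoilOrder

variable {X : Type*}

/-- `lt` is a strict order, total on each class of the partial equivalence relation `E`, with finite
intervals, such that classes having a largest or a smallest element are finite. -/
structure IsFoilOrder (E lt : X → X → Prop) : Prop where
  symm : ∀ {x y}, E x y → E y x
  trans : ∀ {x y z}, E x y → E y z → E x z
  of_lt : ∀ {x y}, lt x y → E x y
  trichotomy : ∀ {x y}, E x y → lt x y ∨ x = y ∨ lt y x
  irrefl : ∀ x, ¬ lt x x
  lt_trans : ∀ {x y z}, lt x y → lt y z → lt x z
  finite_between : ∀ x y, {z | lt x z ∧ lt z y}.Finite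
  finite_of_max : ∀ x, (∀ z, ¬ lt x z) → {y | E x y}.Finite
  finite_of_min : ∀ x, (∀ z, ¬ lt z x) → {y | E x y}.Finite

/-- `y` follows `x` in the cyclic completion of the order `lt` on the class of `x`: either `y` is
the successor of `x`, or `x` is the largest and `y` the smallest element of the class. -/
def IsNext (E lt : X → X → Prop) (x y : X) : Prop :=
  (lt x y ∧ ∀ z, ¬ (lt x z ∧ lt z y)) ∨ (E x y ∧ (∀ z, ¬ lt x z) ∧ ∀ z, ¬ lt z y)

namespace IsFoilOrder

variable {E lt : X → X → Prop}

theorem flip (h : IsFoilOrder E lt) : IsFoilOrder E (fun x y => lt y x) where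
  symm := h.symm
  trans := h.trans
  of_lt hxy := h.symm (h.of_lt hxy)
  trichotomy hxy := by
    rcases h.trichotomy hxy with h1 | h1 | h1
    · exact .inr (.inr h1)
    · exact .inr (.inl h1)
    · exact .inl h1
  irrefl := h.irrefl
  lt_trans h1 h2 := h.lt_trans h2 h1
  finite_between x y := (h.finite_between y x).subset fun _ hz => ⟨hz.2, hz.1⟩
  finite_of_max := h.finite_of_min
  finite_of_min := h.finite_of_max

theorem isNext_flip (h : IsFoilOrder E lt) {x y : X} :
    IsNext E (fun x y => lt y x) y x ↔ IsNext E lt x y := by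
  have hE : E y x ↔ E x y := ⟨h.symm, h.symm⟩
  simp only [IsNext, hE, and_comm]

theorem exists_minimal (h : IsFoilOrder E lt) {A : Set X} (hA : A.Finite) (hne : A.Nonempty) :
    ∃ m ∈ A, ∀ z ∈ A, ¬ lt z m := by
  have : IsStrictOrder X lt :=
    { irrefl := h.irrefl, trans := fun _ _ _ => h.lt_trans }
  obtain ⟨a, ha⟩ := hne
  obtain ⟨m, -, hm⟩ := (hA.wellFoundedOn (r := lt)).has_min univ ⟨⟨a, ha⟩, trivial⟩
  exact ⟨m, m.2, fun z hz => hm ⟨z, hz⟩ trivial⟩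

theorem exists_next (h : IsFoilOrder E lt) {x : X} (hx : E x x) : ∃ y, IsNext E lt x y := by
  by_cases hmax : ∃ z, lt x z
  · obtain ⟨z, hz⟩ := hmax
    have hfin : {w | lt x w ∧ (w = z ∨ lt w z)}.Finite :=
      ((h.finite_between x z).insert z).subset fun w hw =>
        Or.imp id (fun hwz => show lt x w ∧ lt w z from ⟨hw.1, hwz⟩) hw.2
    obtain ⟨m, hm, hmin⟩ := h.exists_minimal hfin ⟨z, hz, .inl rfl⟩
    refine ⟨m, .inl ⟨hm.1, fun w hw => hmin w ⟨hw.1, .inr ?_⟩ hw.2⟩⟩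
    rcases hm.2 with rfl | hmz
    · exact hw.2
    · exact h.lt_trans hw.2 hmz
  · push Not at hmax
    obtain ⟨m, hm, hmin⟩ := h.exists_minimal (h.finite_of_max x hmax) ⟨x, hx⟩
    exact ⟨m, .inr ⟨hm, hmax, fun z hz => hmin z (h.trans hm (h.symm (h.of_lt hz))) hz⟩⟩

theorem exists_prev (h : IsFoilOrder E lt) {y : X} (hy : E y y) : ∃ x, IsNext E lt x y := by
  obtain ⟨x, hx⟩ := h.flip.exists_next hy
  exact ⟨x, h.isNext_flip.1 hx⟩

theorem rel_of_isNext (h : IsFoilOrder E lt) {x y : X} (hxy : IsNext E lt x y) : E x y :=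
  hxy.elim (fun hs => h.of_lt hs.1) fun hw => hw.1

theorem isNext_right_unique (h : IsFoilOrder E lt) {x y y' : X} (hy : IsNext E lt x y)
    (hy' : IsNext E lt x y') : y = y' := by
  have hE : E y y' := h.trans (h.symm (h.rel_of_isNext hy)) (h.rel_of_isNext hy')
  rcases hy with ⟨h1, h2⟩ | ⟨-, h2, h3⟩ <;> rcases hy' with ⟨h1', h2'⟩ | ⟨-, h2', h3'⟩
  · rcases h.trichotomy hE with hlt | rfl | hlt
    · exact (h2' _ ⟨h1, hlt⟩).elim
    · rfl
    · exact (h2 _ ⟨h1', hlt⟩).elim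
  · exact (h2' _ h1).elim
  · exact (h2 _ h1').elim
  · rcases h.trichotomy hE with hlt | rfl | hlt
    · exact (h3' _ hlt).elim
    · rfl
    · exact (h3 _ hlt).elim

theorem isNext_left_unique (h : IsFoilOrder E lt) {x x' y : X} (hx : IsNext E lt x y)
    (hx' : IsNext E lt x' y) : x = x' :=
  h.flip.isNext_right_unique (h.isNext_flip.2 hx) (h.isNext_flip.2 hx')

variable {T : X → X}

theorem bijOn (h : IsFoilOrder E lt) (hT : ∀ x, E x x → IsNext E lt x (T x)) :
    BijOn T {x | E x x} {x | E x x} := by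
  refine ⟨fun x hx => ?_, fun x hx y hy hxy => ?_, fun y hy => ?_⟩
  · have hE := h.rel_of_isNext (hT x hx)
    exact h.trans (h.symm hE) hE
  · exact h.isNext_left_unique (hT x hx) (hxy ▸ hT y hy)
  · obtain ⟨x, hx⟩ := h.exists_prev hy
    have hE := h.rel_of_isNext hx
    have hxx : E x x := h.trans hE (h.symm hE)
    exact ⟨x, hxx, h.isNext_right_unique (hT x hxx) hx⟩

theorem rel_iterate (h : IsFoilOrder E lt) (hT : ∀ x, E x x → IsNext E lt x (T x)) {x : X}
    (hx : E x x) (n : ℕ) : E x (T^[n] x) := by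
  induction n with
  | zero => exact hx
  | succ n ih =>
    rw [iterate_succ_apply']
    exact h.trans ih (h.rel_of_isNext (hT _ (h.trans (h.symm ih) ih)))

theorem exists_iterate_eq_of_lt (h : IsFoilOrder E lt)
    (hT : ∀ x, E x x → IsNext E lt x (T x)) {x y : X} (hxy : lt x y) : ∃ n, T^[n] x = y := by
  induction hk : {z | lt x z ∧ lt z y}.ncard using Nat.strong_induction_on generalizing x with
  | _ k ih =>
    have hE := h.of_lt hxy
    rcases hT x (h.trans hE (h.symm hE)) with ⟨h1, h2⟩ | ⟨-, h2, -⟩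
    · rcases h.trichotomy (h.trans (h.symm (h.of_lt h1)) hE) with hlt | heq | hlt
      · have hsub : {z | lt (T x) z ∧ lt z y} ⊂ {z | lt x z ∧ lt z y} := by
          have hle : {z | lt (T x) z ∧ lt z y} ⊆ {z | lt x z ∧ lt z y} :=
            fun z hz => ⟨h.lt_trans h1 hz.1, hz.2⟩
          exact (Set.ssubset_iff_of_subset hle).2 ⟨T x, ⟨h1, hlt⟩, fun hz => h.irrefl _ hz.1⟩
        have hcard := Set.ncard_lt_ncard hsub (h.finite_between x y)
        obtain ⟨n, hn⟩ := ih _ (hk ▸ hcard) hlt rfl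
        exact ⟨n + 1, hn⟩
      · exact ⟨1, heq⟩
      · exact (h2 _ ⟨hxy, hlt⟩).elim
    · exact (h2 _ hxy).elim

theorem orbit_eq (h : IsFoilOrder E lt) (hT : ∀ x, E x x → IsNext E lt x (T x)) {x y : X}
    (hx : E x x) : (E y y ∧ ∃ n, T^[n] x = y ∨ T^[n] y = x) ↔ E x y := by
  constructor
  · rintro ⟨hy, n, rfl | rfl⟩
    · exact h.rel_iterate hT hx n
    · exact h.symm (h.rel_iterate hT hy n)
  · intro hxy
    refine ⟨h.trans (h.symm hxy) hxy, ?_⟩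
    rcases h.trichotomy hxy with hlt | rfl | hlt
    · exact (h.exists_iterate_eq_of_lt hT hlt).imp fun n hn => .inl hn
    · exact ⟨0, .inl rfl⟩
    · exact (h.exists_iterate_eq_of_lt hT hlt).imp fun n hn => .inr hn

theorem eq_or_lt_iterate (h : IsFoilOrder E lt) (hT : ∀ x, E x x → IsNext E lt x (T x)) {x : X}
    (hx : E x x) (hinf : {y | E x y}.Infinite) (n : ℕ) : T^[n] x = x ∨ lt x (T^[n] x) := by
  induction n with
  | zero => exact .inl rfl
  | succ n ih =>
    rw [iterate_succ_apply']
    have hE := h.rel_iterate hT hx n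
    rcases hT _ (h.trans (h.symm hE) hE) with ⟨h1, -⟩ | ⟨-, h2, -⟩
    · rcases ih with heq | hlt
      · rw [heq] at h1 ⊢
        exact .inr h1
      · exact .inr (h.lt_trans hlt h1)
    · exact (hinf ((h.finite_of_max _ h2).subset fun y hy => h.trans (h.symm hE) hy)).elim

end IsFoilOrder

/-- Two points of `S` are in the same foil of `f`. -/
def SameFoil (S : Set X) (f : X → X) (x y : X) : Prop :=
  x ∈ S ∧ y ∈ S ∧ ∃ n, f^[n] x = f^[n] y

/-- The order on the foils of `f` comparing the last distinct iterates through `κ`. -/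
def FoilLT {α : Type*} [LT α] (S : Set X) (f : X → X) (κ : X → α) (x y : X) : Prop :=
  x ∈ S ∧ y ∈ S ∧ ∃ n, f^[n + 1] x = f^[n + 1] y ∧ κ (f^[n] x) < κ (f^[n] y)

theorem iterate_eq_of_le {f : X → X} {x y : X} {m n : ℕ} (hmn : m ≤ n)
    (h : f^[m] x = f^[m] y) : f^[n] x = f^[n] y := by
  obtain ⟨k, rfl⟩ := Nat.exists_eq_add_of_le' hmn
  rw [iterate_add_apply, iterate_add_apply, h]

variable {α : Type*} [LinearOrder α] {S : Set X} {f : X → X} {κ : X → α}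

theorem sameFoil_self {x : X} : SameFoil S f x x ↔ x ∈ S :=
  ⟨fun h => h.1, fun h => ⟨h, h, 0, rfl⟩⟩

theorem SameFoil.symm {x y : X} (h : SameFoil S f x y) : SameFoil S f y x :=
  ⟨h.2.1, h.1, h.2.2.imp fun _ => Eq.symm⟩

theorem SameFoil.trans {x y z : X} (hxy : SameFoil S f x y) (hyz : SameFoil S f y z) :
    SameFoil S f x z := by
  obtain ⟨hx, -, m, hm⟩ := hxy
  obtain ⟨-, hz, n, hn⟩ := hyz
  exact ⟨hx, hz, max m n, (iterate_eq_of_le (le_max_left m n) hm).trans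
    (iterate_eq_of_le (le_max_right m n) hn)⟩

theorem FoilLT.sameFoil {x y : X} (h : FoilLT S f κ x y) : SameFoil S f x y := by
  obtain ⟨hx, hy, n, hn, -⟩ := h
  exact ⟨hx, hy, n + 1, hn⟩

theorem FoilLT.trans {x y z : X} (hxy : FoilLT S f κ x y) (hyz : FoilLT S f κ y z) :
    FoilLT S f κ x z := by
  obtain ⟨hx, -, m, hm, hm'⟩ := hxy
  obtain ⟨-, hz, n, hn, hn'⟩ := hyz
  refine ⟨hx, hz, max m n, (iterate_eq_of_le (by omega) hm).trans
    (iterate_eq_of_le (by omega) hn), ?_⟩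
  rcases lt_trichotomy m n with h | rfl | h
  · rw [max_eq_right h.le, iterate_eq_of_le h hm]
    exact hn'
  · rw [max_self]
    exact hm'.trans hn'
  · rw [max_eq_left h.le, ← iterate_eq_of_le h hn]
    exact hm'

theorem foilLT_irrefl (x : X) : ¬ FoilLT S f κ x x := fun ⟨_, _, _, _, h⟩ => lt_irrefl _ h

theorem SameFoil.trichotomy (hκ : Injective κ) {x y : X} (h : SameFoil S f x y) :
    FoilLT S f κ x y ∨ x = y ∨ FoilLT S f κ y x := by
  classical
  obtain ⟨hx, hy, hn⟩ := h
  rcases hfind : Nat.find hn with _ | n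
  · have := Nat.find_spec hn
    rw [hfind] at this
    exact .inr (.inl this)
  · have heq := Nat.find_spec hn
    rw [hfind] at heq
    have hne : κ (f^[n] x) ≠ κ (f^[n] y) := hκ.ne (Nat.find_min hn (by omega))
    rcases hne.lt_or_gt with hlt | hlt
    · exact .inl ⟨hx, hy, n, heq, hlt⟩
    · exact .inr (.inr ⟨hy, hx, n, heq.symm, hlt⟩)

theorem FoilLT.iterate_eq_between {x y z : X} {n : ℕ} (hxy : f^[n] x = f^[n] y)
    (hxz : FoilLT S f κ x z) (hzy : FoilLT S f κ z y) : f^[n] z = f^[n] x := by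
  obtain ⟨-, -, m, hm, hm'⟩ := hxz
  obtain ⟨-, -, k, hk, hk'⟩ := hzy
  rcases le_or_gt n m with hnm | hnm
  · rcases lt_trichotomy m k with h | rfl | h
    · rw [← iterate_eq_of_le h hm, iterate_eq_of_le (hnm.trans h.le) hxy] at hk'
      exact (lt_irrefl _ hk').elim
    · rw [iterate_eq_of_le hnm hxy] at hm'
      exact (lt_asymm hm' hk').elim
    · rw [iterate_eq_of_le h hk, iterate_eq_of_le hnm hxy] at hm'
      exact (lt_irrefl _ hm').elim
  · exact (iterate_eq_of_le hnm hm).symm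

theorem FoilLT.map_eq_or_lt (hf : MapsTo f S S) {x y : X} (h : FoilLT S f κ x y) :
    f x = f y ∨ FoilLT S f κ (f x) (f y) := by
  obtain ⟨hx, hy, n, hn, hlt⟩ := h
  rcases n with _ | n
  · exact .inl hn
  · exact .inr ⟨hf hx, hf hy, n, hn, hlt⟩

theorem isFoilOrder_foilLT (hκ : Injective κ) (hfib : ∀ n y, {x | f^[n] x = y}.Finite)
    (hmax : ∀ x, (∀ z, ¬ FoilLT S f κ x z) → {y | SameFoil S f x y}.Finite)
    (hmin : ∀ x, (∀ z, ¬ FoilLT S f κ z x) → {y | SameFoil S f x y}.Finite) :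
    IsFoilOrder (SameFoil S f) (FoilLT S f κ) where
  symm := SameFoil.symm
  trans := SameFoil.trans
  of_lt := FoilLT.sameFoil
  trichotomy := SameFoil.trichotomy hκ
  irrefl := foilLT_irrefl
  lt_trans := FoilLT.trans
  finite_between x y := by
    by_cases hxy : SameFoil S f x y
    · obtain ⟨-, -, n, hn⟩ := hxy
      exact (hfib n (f^[n] x)).subset fun z hz => hz.1.iterate_eq_between hn hz.2
    · convert Set.finite_empty
      exact Set.eq_empty_of_forall_notMem fun z hz => hxy (hz.1.trans hz.2).sameFoil
  finite_of_max := hmax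
  finite_of_min := hmin

end FoilOrder

section MassTransport

variable {d : ℕ}

theorem measurable_shift (t : Pt d) : Measurable (shift t) :=
  measurable_pi_lambda _ fun x => measurable_pi_apply (x + t)

theorem shift_shift (s t : Pt d) (ω : Conf d) : shift s (shift t ω) = shift (s + t) ω := by
  funext x
  simp only [shift, add_assoc]

/-- A relation between grid points depending on the configuration in a shift-equivariant way. -/
def IsEquivariant (R : Conf d → Pt d → Pt d → Prop) : Prop :=
  ∀ t ω x y, R (shift t ω) x y ↔ R ω (x + t) (y + t)

variable {μ : Measure (Conf d)} {R : Conf d → Pt d → Pt d → Prop}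

theorem lintegral_shift (hinv : ∀ t : Pt d, μ.map (shift t) = μ) (t : Pt d) {u : Conf d → ℝ≥0∞}
    (hu : Measurable u) : ∫⁻ ω, u (shift t ω) ∂μ = ∫⁻ ω, u ω ∂μ := by
  rw [← lintegral_map hu (measurable_shift t), hinv]

theorem ae_forall_shift (hinv : ∀ t : Pt d, μ.map (shift t) = μ) {p : Conf d → Prop}
    (hp : ∀ᵐ ω ∂μ, p ω) : ∀ᵐ ω ∂μ, ∀ t, p (shift t ω) :=
  ae_all_iff.2 fun t => ae_of_ae_map (measurable_shift t).aemeasurable ((hinv t).symm ▸ hp)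

open Classical in
/-- The mass transport principle. -/
theorem lintegral_tsum_comm (hinv : ∀ t : Pt d, μ.map (shift t) = μ)
    (hR : IsEquivariant R) (hm : ∀ x y, Measurable fun ω => R ω x y) :
    ∫⁻ ω, ∑' x, (if R ω x 0 then 1 else 0 : ℝ≥0∞) ∂μ =
      ∫⁻ ω, ∑' y, (if R ω 0 y then 1 else 0 : ℝ≥0∞) ∂μ := by
  have hmeas : ∀ x y, Measurable fun ω => (if R ω x y then 1 else 0 : ℝ≥0∞) := fun x y =>
    Measurable.ite (measurableSet_setOfPred.2 (hm x y)) measurable_const measurable_const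
  rw [lintegral_tsum fun x => (hmeas x 0).aemeasurable,
    lintegral_tsum fun y => (hmeas 0 y).aemeasurable, ← (Equiv.neg (Pt d)).tsum_eq]
  refine tsum_congr fun y => ?_
  rw [← lintegral_shift hinv y (hmeas _ _)]
  refine lintegral_congr fun ω => ?_
  simp only [hR y ω, Equiv.neg_apply, neg_add_cancel, zero_add]

theorem ae_finite_setOf_rel [IsProbabilityMeasure μ] (hinv : ∀ t : Pt d, μ.map (shift t) = μ)
    (hR : IsEquivariant R) (hm : ∀ x y, Measurable fun ω => R ω x y)
    (huniq : ∀ ω x y y', R ω x y → R ω x y' → y = y') :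
    ∀ᵐ ω ∂μ, ∀ y, {x | R ω x y}.Finite := by
  classical
  have hle : ∀ ω, ∑' y, (if R ω 0 y then 1 else 0 : ℝ≥0∞) ≤ 1 := fun ω => by
    by_cases hex : ∃ y, R ω 0 y
    · obtain ⟨y₀, hy₀⟩ := hex
      rw [tsum_eq_single y₀ fun y hy => if_neg fun h => hy (huniq ω 0 _ _ h hy₀)]
      simp [hy₀]
    · push Not at hex
      simp [hex]
  have hmeas : ∀ x y, Measurable fun ω => (if R ω x y then 1 else 0 : ℝ≥0∞) := fun x y =>
    Measurable.ite (measurableSet_setOfPred.2 (hm x y)) measurable_const measurable_const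
  have hfin : ∫⁻ ω, ∑' x, (if R ω x 0 then 1 else 0 : ℝ≥0∞) ∂μ ≠ ∞ := by
    rw [lintegral_tsum_comm hinv hR hm]
    refine ((lintegral_mono hle).trans_lt ?_).ne
    simp
  have hzero : ∀ᵐ ω ∂μ, {x | R ω x 0}.Finite := by
    filter_upwards [ae_lt_top (Measurable.tsum fun x => hmeas x 0) hfin] with ω hω
    have hone := ENNReal.finite_const_le_of_tsum_ne_top hω.ne one_ne_zero
    refine hone.subset fun x hx => ?_
    simp [show R ω x 0 from hx]
  filter_upwards [ae_forall_shift hinv hzero] with ω hω y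
  refine ((hω y).image (· + y)).subset fun x hx => ⟨x - y, ?_, sub_add_cancel x y⟩
  simpa [hR y ω] using hx

end MassTransport

section Foils

variable {d : ℕ} {g : Conf d → Pt d}

/-- Two points of the configuration are in the same foil of the point-shift. -/
def Foil (g : Conf d → Pt d) (ω : Conf d) : Pt d → Pt d → Prop :=
  SameFoil (pts ω) (Fps g ω)

/-- The order on the foils of a point-shift induced by the lexicographic order of the grid. -/
def LexFoilLT (g : Conf d → Pt d) (ω : Conf d) : Pt d → Pt d → Prop :=
  FoilLT (pts ω) (Fps g ω) (toLex : Pt d → Lex (Pt d))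

theorem mapsTo_fps (hg : IsPointMap g) (ω : Conf d) : MapsTo (Fps g ω) (pts ω) (pts ω) := by
  intro x hx
  have h := hg.2 (shift x ω) (by simpa [shift] using show ω x = true from hx)
  simpa [pts, Fps, shift, add_comm] using h

theorem fps_shift_iterate (t : Pt d) (ω : Conf d) (x : Pt d) (n : ℕ) :
    (Fps g (shift t ω))^[n] x + t = (Fps g ω)^[n] (x + t) := by
  have h : Semiconj (· + t) (Fps g (shift t ω)) (Fps g ω) := fun y => by
    simp only [Fps, shift_shift]
    abel
  exact (h.iterate_right n).eq x

theorem fps_shift_iterate_eq (t : Pt d) (ω : Conf d) (x : Pt d) (n : ℕ) :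
    (Fps g (shift t ω))^[n] x = (Fps g ω)^[n] (x + t) - t :=
  eq_sub_of_add_eq (fps_shift_iterate t ω x n)

theorem toLex_sub_lt_sub_iff (a b t : Pt d) :
    toLex (a - t) < toLex (b - t) ↔ toLex a < toLex b := by
  change (∃ i, (∀ j, j < i → a j - t j = b j - t j) ∧ a i - t i < b i - t i) ↔
    ∃ i, (∀ j, j < i → a j = b j) ∧ a i < b i
  simp only [sub_left_inj, sub_lt_sub_iff_right]

theorem isEquivariant_foil : IsEquivariant (Foil g) := fun t ω x y => by
  simp only [Foil, SameFoil, fps_shift_iterate_eq, sub_left_inj]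
  rfl

theorem isEquivariant_lexFoilLT : IsEquivariant (LexFoilLT g) := fun t ω x y => by
  simp only [LexFoilLT, FoilLT, fps_shift_iterate_eq, sub_left_inj, toLex_sub_lt_sub_iff]
  rfl

theorem measurable_fps (hg : Measurable g) (x : Pt d) : Measurable fun ω => Fps g ω x :=
  (hg.comp (measurable_shift x)).const_add x

theorem measurable_fps_iterate (hg : Measurable g) (n : ℕ) (x : Pt d) :
    Measurable fun ω => (Fps g ω)^[n] x := by
  induction n with
  | zero => exact measurable_const
  | succ n ih =>
    simp only [iterate_succ_apply']
    exact (measurable_from_prod_countable_left (f := fun p : Conf d × Pt d => Fps g p.1 p.2)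
      fun y => measurable_fps hg y).comp (measurable_id.prodMk ih)

theorem measurable_rel {Ω' X : Type*} [MeasurableSpace Ω'] [MeasurableSpace X] [Countable X]
    [MeasurableSingletonClass X] (r : X → X → Prop) {u v : Ω' → X} (hu : Measurable u)
    (hv : Measurable v) : Measurable fun ω => r (u ω) (v ω) :=
  (Measurable.of_discrete (f := fun p : X × X => r p.1 p.2)).comp (hu.prodMk hv)

theorem measurable_mem_pts (x : Pt d) : Measurable fun ω : Conf d => x ∈ pts ω :=
  (Measurable.of_discrete (f := fun b : Bool => b = true)).comp (measurable_pi_apply x)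

theorem measurable_foil (hg : Measurable g) (x y : Pt d) : Measurable fun ω => Foil g ω x y :=
  (measurable_mem_pts x).and ((measurable_mem_pts y).and (.exists fun n =>
    measurable_rel (· = ·) (measurable_fps_iterate hg n x) (measurable_fps_iterate hg n y)))

theorem measurable_lexFoilLT (hg : Measurable g) (x y : Pt d) :
    Measurable fun ω => LexFoilLT g ω x y :=
  (measurable_mem_pts x).and ((measurable_mem_pts y).and (.exists fun n =>
    (measurable_rel (· = ·) (measurable_fps_iterate hg (n + 1) x)
      (measurable_fps_iterate hg (n + 1) y)).and
    (measurable_rel (fun a b => toLex a < toLex b) (measurable_fps_iterate hg n x)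
      (measurable_fps_iterate hg n y))))

/-- The point `y` follows `x` in its foil, the finite foils being ordered cyclically. -/
def FoilNext (g : Conf d → Pt d) (ω : Conf d) : Pt d → Pt d → Prop :=
  IsNext (Foil g ω) (LexFoilLT g ω)

theorem measurable_foilNext (hg : Measurable g) (x y : Pt d) :
    Measurable fun ω => FoilNext g ω x y := by
  have hE := measurable_foil hg
  have hlt := measurable_lexFoilLT hg
  exact ((hlt x y).and (.forall fun z => ((hlt x z).and (hlt z y)).not)).or
    ((hE x y).and ((Measurable.forall fun z => (hlt x z).not).and
      (.forall fun z => (hlt z y).not)))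

theorem isEquivariant_foilNext : IsEquivariant (FoilNext g) := fun t ω x y => by
  simp only [FoilNext, IsNext, isEquivariant_foil t ω, isEquivariant_lexFoilLT t ω]
  have key : ∀ p : Pt d → Prop, (∀ z, p (z + t)) ↔ ∀ z, p z := fun p =>
    (Equiv.addRight t).forall_congr_right (q := p)
  rw [key fun z => ¬ (LexFoilLT g ω (x + t) z ∧ LexFoilLT g ω z (y + t)),
    key fun z => ¬ LexFoilLT g ω (x + t) z, key fun z => ¬ LexFoilLT g ω z (y + t)]

theorem exists_measurable_selection {Ω' X : Type*} [MeasurableSpace Ω'] [MeasurableSpace X]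
    [Countable X] (x₀ : X) {p : Ω' → X → Prop} (hp : ∀ x, Measurable fun ω => p ω x) :
    ∃ s : Ω' → X, Measurable s ∧ ∀ ω, p ω (s ω) ∨ (s ω = x₀ ∧ ∀ x, ¬ p ω x) := by
  classical
  have : Nonempty X := ⟨x₀⟩
  obtain ⟨e, he⟩ := exists_surjective_nat X
  let q : Ω' → ℕ → Prop := fun ω n => (n = 0 ∧ ∀ x, ¬ p ω x) ∨ ∃ k, n = k + 1 ∧ p ω (e k)
  have hq : ∀ ω, ∃ n, q ω n := fun ω => by
    by_cases h : ∃ x, p ω x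
    · obtain ⟨x, hx⟩ := h
      obtain ⟨k, rfl⟩ := he x
      exact ⟨k + 1, .inr ⟨k, rfl, hx⟩⟩
    · push Not at h
      exact ⟨0, .inl ⟨rfl, h⟩⟩
  have hmeas : Measurable fun ω => Nat.find (hq ω) := by
    refine measurable_find hq fun n => measurableSet_setOfPred.2 ?_
    exact (measurable_const.and (.forall fun x => (hp x).not)).or
      (.exists fun k => measurable_const.and (hp (e k)))
  let c : ℕ → X := fun n => if n = 0 then x₀ else e (n - 1)
  refine ⟨fun ω => c (Nat.find (hq ω)), (Measurable.of_discrete (f := c)).comp hmeas, fun ω => ?_⟩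
  rcases Nat.find_spec (hq ω) with ⟨h0, hn⟩ | ⟨k, hk, hpk⟩
  · exact .inr ⟨by simp only [h0, c, if_true], hn⟩
  · left
    simpa [hk, c] using hpk

variable {μ : Measure (Conf d)} [IsProbabilityMeasure μ]

theorem ae_finite_foil_of_extremal (hinv : ∀ t : Pt d, μ.map (shift t) = μ)
    (hg : Measurable g) {lt : Conf d → Pt d → Pt d → Prop} (hlt : IsEquivariant lt)
    (hm : ∀ x y, Measurable fun ω => lt ω x y)
    (htri : ∀ ω x y, Foil g ω x y → lt ω x y ∨ x = y ∨ lt ω y x) :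
    ∀ᵐ ω ∂μ, ∀ x, (∀ z, ¬ lt ω x z) → {y | Foil g ω x y}.Finite := by
  have hfin := ae_finite_setOf_rel (μ := μ)
    (R := fun ω x y => Foil g ω x y ∧ ∀ z, ¬ lt ω y z) hinv
    (fun t ω x y => by
      simp only [isEquivariant_foil t ω, hlt t ω]
      have key := (Equiv.addRight t).forall_congr_right (q := fun z => ¬ lt ω (y + t) z)
      exact and_congr_right' key)
    (fun x y => (measurable_foil hg x y).and (.forall fun z => (hm y z).not))
    (fun ω x y y' h h' => by
      rcases htri ω y y' (h.1.symm.trans h'.1) with h1 | h1 | h1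
      · exact (h.2 _ h1).elim
      · exact h1
      · exact (h'.2 _ h1).elim)
  filter_upwards [hfin] with ω hω x hx
  exact (hω x).subset fun y hy => ⟨hy.symm, hx⟩

theorem ae_isFoilOrder (hinv : ∀ t : Pt d, μ.map (shift t) = μ) (hg : Measurable g) :
    ∀ᵐ ω ∂μ, IsFoilOrder (Foil g ω) (LexFoilLT g ω) := by
  have htri : ∀ ω x y, Foil g ω x y → LexFoilLT g ω x y ∨ x = y ∨ LexFoilLT g ω y x :=
    fun ω x y h => SameFoil.trichotomy toLex.injective h
  have hfib : ∀ᵐ ω ∂μ, ∀ n y, {x | (Fps g ω)^[n] x = y}.Finite :=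
    ae_all_iff.2 fun n => ae_finite_setOf_rel (R := fun ω x y => (Fps g ω)^[n] x = y) hinv
      (fun t ω x y => by simp only [fps_shift_iterate_eq, sub_eq_iff_eq_add])
      (fun x y => measurable_rel (· = ·) (measurable_fps_iterate hg n x) measurable_const)
      (fun ω x y y' h h' => h.symm.trans h')
  have hmax := ae_finite_foil_of_extremal hinv hg isEquivariant_lexFoilLT
    (measurable_lexFoilLT hg) htri
  have hmin := ae_finite_foil_of_extremal (lt := fun ω x y => LexFoilLT g ω y x) hinv hg
    (fun t ω x y => isEquivariant_lexFoilLT t ω y x) (fun x y => measurable_lexFoilLT hg y x)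
    (fun ω x y h => (htri ω y x h.symm).imp id (Or.imp Eq.symm id))
  filter_upwards [hfib, hmax, hmin] with ω h1 h2 h3
  exact isFoilOrder_foilLT toLex.injective h1 h2 h3

end Foils

end PointShift


/-- For every point-shift `F` there is a bijective point-shift `F_⊥`
whose two-sided orbits are exactly the foils of `F`, and which, on components all of
whose foils are infinite, induces an order on each foil that is preserved by `F`
(`x ⪯ y → F x ⪯ F y`, where `x ⪯ y` iff `y = F_⊥^[k] x` for some `k ≥ 0`). -/
theorem stmt_14 {d : ℕ} (hd : 0 < d)
    (μ : Measure (PointShift.Conf d)) [IsProbabilityMeasure μ]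
    (hinv : ∀ t : PointShift.Pt d, μ.map (PointShift.shift t) = μ)
    (hpos : 0 < μ {ω : PointShift.Conf d | ω 0 = true})
    (g : PointShift.Conf d → PointShift.Pt d) (hg : PointShift.IsPointMap g) :
    ∃ gbot : PointShift.Conf d → PointShift.Pt d, PointShift.IsPointMap gbot ∧
      ∀ᵐ ω ∂μ,
        -- (i) `F_⊥` is a bijection of the support of `ω`
        Set.BijOn (PointShift.Fps gbot ω) (PointShift.pts ω) (PointShift.pts ω) ∧
        -- (ii) the two-sided orbit of every point is its foil
        (∀ x : PointShift.Pt d, ω x = true →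
          {y : PointShift.Pt d | ω y = true ∧ ∃ n : ℕ,
              (PointShift.Fps gbot ω)^[n] x = y ∨ (PointShift.Fps gbot ω)^[n] y = x} =
            PointShift.foilOn g ω x) ∧
        -- (iii) on components with all foils infinite, the orbit order is preserved by `F`
        (∀ x : PointShift.Pt d, ω x = true →
          (∀ y ∈ PointShift.compOn g ω x, (PointShift.foilOn g ω y).Infinite) →
          ∀ k : ℕ, ∃ m : ℕ,
            (PointShift.Fps gbot ω)^[m] (PointShift.Fps g ω x) =
              PointShift.Fps g ω ((PointShift.Fps gbot ω)^[k] x)) := by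
  classical
  obtain ⟨s, hs, hsel⟩ := PointShift.exists_measurable_selection (0 : PointShift.Pt d)
    (p := fun ω y => PointShift.FoilNext g ω 0 y) (PointShift.measurable_foilNext hg.1 0)
  refine ⟨s, ⟨hs, fun ω h0 => ?_⟩, ?_⟩
  · rcases hsel ω with h | ⟨h, -⟩
    · rcases h with ⟨h, -⟩ | ⟨h, -⟩
      · exact h.2.1
      · exact h.2.1
    · rw [h, h0]
  filter_upwards [PointShift.ae_isFoilOrder hinv hg.1] with ω hω
  have hself : ∀ x, PointShift.Foil g ω x x ↔ x ∈ PointShift.pts ω := fun x =>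
    PointShift.sameFoil_self
  have hT : ∀ x, PointShift.Foil g ω x x →
      PointShift.IsNext (PointShift.Foil g ω) (PointShift.LexFoilLT g ω) x
        (PointShift.Fps s ω x) := by
    intro x hx
    have htransfer : ∀ y, PointShift.FoilNext g (PointShift.shift x ω) 0 y ↔
        PointShift.FoilNext g ω x (x + y) := fun y => by
      rw [PointShift.isEquivariant_foilNext x ω, zero_add, add_comm y x]
    obtain ⟨y, hy⟩ := hω.exists_next hx
    rcases hsel (PointShift.shift x ω) with h | ⟨-, h⟩
    · exact (htransfer _).1 h
    · exact (h (y - x) ((htransfer _).2 (by rwa [add_sub_cancel]))).elim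
  have hfoil : ∀ x, ω x = true → PointShift.foilOn g ω x = {y | PointShift.Foil g ω x y} := by
    intro x hx
    ext y
    exact ⟨fun h => ⟨hx, h.1, h.2.imp fun _ => Eq.symm⟩,
      fun h => ⟨h.2.1, h.2.2.imp fun _ => Eq.symm⟩⟩
  refine ⟨?_, fun x hx => ?_, fun x hx hinf k => ?_⟩
  · have hbij := hω.bijOn hT
    rwa [show {x | PointShift.Foil g ω x x} = PointShift.pts ω from Set.ext hself] at hbij
  · rw [hfoil x hx]
    ext y
    have horbit := hω.orbit_eq hT (y := y) ((hself x).2 hx)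
    rw [hself y] at horbit
    exact horbit
  · have hx_inf := hinf x ⟨hx, 0, 0, rfl⟩
    rw [hfoil x hx] at hx_inf
    rcases hω.eq_or_lt_iterate hT ((hself x).2 hx) hx_inf k with h | h
    · exact ⟨0, by rw [h]; rfl⟩
    · rcases PointShift.FoilLT.map_eq_or_lt (PointShift.mapsTo_fps hg ω) h with heq | hlt
      · exact ⟨0, heq⟩
      · exact hω.exists_iterate_eq_of_lt hT hlt
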